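/- For every 0 ≤ m ≤ ⌊n/2⌋, every standard Young tableau Q of shape (n−m,m), and every 0 ≤ ℓ ≤ n−2m, the function f_Q^{m,ℓ} is nonzero and is an eigenvector of K_n: if m+ℓ is even then K_n f_Q^{m,ℓ} = β_{(m+ℓ)/2} f_Q^{m,ℓ} with β_k = C(2k,k)²/16^k, and if m+ℓ is odd then K_n f_Q^{m,ℓ} = 0. -/

import Mathlib

open Finset

attribute [local instance] Classical.propDecidable

/-- Stationary distribution of the binary Burnside process. -/
noncomputable def piDist (n : ℕ) (U : Finset ℕ) : ℝ :=
  1 / ((n + 1) * (n.choose U.card))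

/-- Binary Burnside transition matrix entry. -/
noncomputable def Kmat (n : ℕ) (x y : Finset ℕ) : ℝ :=
  (((2 * (n - (x ∪ y).card)).choose (n - (x ∪ y).card) : ℝ) *
      ((2 * ((y \ x).card)).choose ((y \ x).card)) *
      ((2 * ((x \ y).card)).choose ((x \ y).card)) *
      ((2 * ((x ∩ y).card)).choose ((x ∩ y).card))) /
    (4 ^ n * (((n - (x ∪ y).card) + (y \ x).card).choose (n - (x ∪ y).card)) *
      (((x \ y).card + (x ∩ y).card).choose ((x \ y).card)))

/-- Action of K_n on functions. -/
noncomputable def Kop (n : ℕ) (f : Finset ℕ → ℝ) : Finset ℕ → ℝ :=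
  fun x => ∑ y ∈ (Finset.Icc 1 n).powerset, Kmat n x y * f y

/-- s-step transition probabilities. -/
noncomputable def Kpow (n : ℕ) : ℕ → Finset ℕ → Finset ℕ → ℝ
  | 0 => fun x y => if x = y then 1 else 0
  | s + 1 => fun x y => ∑ z ∈ (Finset.Icc 1 n).powerset, Kmat n x z * Kpow n s z y

/-- Chi-square distance to stationarity after s steps, started at x. -/
noncomputable def chiSq (n s : ℕ) (x : Finset ℕ) : ℝ :=
  ∑ y ∈ (Finset.Icc 1 n).powerset, (Kpow n s x y - piDist n y) ^ 2 / piDist n y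

/-- Eigenvalues. -/
noncomputable def betaEV (k : ℕ) : ℝ := (((2 * k).choose k : ℝ)) ^ 2 / 16 ^ k

/-- The eigenvectors f_S of Diaconis–Lin–Ram. -/
noncomputable def fSvec (S : Finset ℕ) : Finset ℕ → ℝ :=
  fun U => (-1 : ℝ) ^ ((S ∩ U).card) * (S.card.choose ((S ∩ U).card))

/-- Inner product with respect to π. -/
noncomputable def innerPi (n : ℕ) (f g : Finset ℕ → ℝ) : ℝ :=
  ∑ U ∈ (Finset.Icc 1 n).powerset, f U * g U * piDist n U

/-- The scalars T_{m,n}^{(ℓ)}(i). -/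
noncomputable def Tcoef (n m ℓ i : ℕ) : ℝ :=
  ∑ j ∈ Finset.range (i + 1),
    if j ≤ ℓ then
      (-1 : ℝ) ^ (m + j) * ((2 * m + ℓ).choose (m + j)) * (i.choose j) *
        ((n - 2 * m - i).choose (ℓ - j))
    else 0

/-- The vector g_T^{m,i} associated to the column reading tableau. -/
noncomputable def gT (n m i : ℕ) : Finset ℕ → ℝ := fun U =>
  if (∀ r ∈ Finset.Icc 1 m, ((2 * r - 1 ∈ U) ↔ ¬(2 * r ∈ U))) ∧
      (U ∩ Finset.Icc (2 * m + 1) n).card = i then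
    (-1 : ℝ) ^ ((U ∩ (Finset.range m).image (fun r => 2 * r + 1)).card)
  else 0

/-- The vector f_T^{m,ℓ} associated to the column reading tableau. -/
noncomputable def fT (n m ℓ : ℕ) : Finset ℕ → ℝ :=
  fun U => ∑ i ∈ Finset.range (n - 2 * m + 1), Tcoef n m ℓ i * gT n m i U

/-- Action of the adjacent transposition s_t (switching t and t+1) on functions. -/
noncomputable def sOp (t : ℕ) (f : Finset ℕ → ℝ) : Finset ℕ → ℝ :=
  fun U => f (U.image (Equiv.swap t (t + 1)))

/-- The factor s_t − 1/(t − 2r + 2) (r is the 1-indexed position in the second row). -/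
noncomputable def tauFactor (r t : ℕ) (f : Finset ℕ → ℝ) : Finset ℕ → ℝ :=
  fun U => sOp t f U - ((t : ℝ) - 2 * r + 2)⁻¹ * f U

/-- Composition (s_{2r+k-1} − ⋯)⋯(s_{2r} − 1/2) of k successive factors. -/
noncomputable def tauComp (r : ℕ) : ℕ → (Finset ℕ → ℝ) → (Finset ℕ → ℝ)
  | 0 => id
  | k + 1 => fun f => tauFactor r (2 * r + k) (tauComp r k f)

/-- τ_Q^{(r)} τ_Q^{(r+1)} ⋯ for the remaining second-row entries. -/
noncomputable def tauQAux : ℕ → List ℕ → (Finset ℕ → ℝ) → (Finset ℕ → ℝ)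
  | _, [] => id
  | r, a :: rest => fun f => tauComp r (a - 2 * r) (tauQAux (r + 1) rest f)

/-- The operator τ_Q for a tableau Q encoded by its list of second-row entries. -/
noncomputable def tauQ (Q : List ℕ) : (Finset ℕ → ℝ) → (Finset ℕ → ℝ) := tauQAux 1 Q

/-- A standard Young tableau of shape (n − Q.length, Q.length), encoded by the strictly
increasing list of second-row entries, each entry a_r satisfying 2r ≤ a_r ≤ n. -/
def IsSYT (n : ℕ) (Q : List ℕ) : Prop :=
  Q.Chain' (· < ·) ∧ (∀ x ∈ Q, x ≤ n) ∧ ∀ r < Q.length, 2 * (r + 1) ≤ Q.getD r 0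

/-- The eigenvectors f_Q^{m,ℓ} (here m = Q.length). -/
noncomputable def fQvec (n : ℕ) (Q : List ℕ) (ℓ : ℕ) : Finset ℕ → ℝ :=
  tauQ Q (fT n Q.length ℓ)

/-- The orthogonal vectors g_Q^{m,i} (here m = Q.length). -/
noncomputable def gQvec (n : ℕ) (Q : List ℕ) (i : ℕ) : Finset ℕ → ℝ :=
  tauQ Q (gT n Q.length i)

/-- The constant γ_Q. -/
noncomputable def gammaQ (Q : List ℕ) : ℝ :=
  ∏ r ∈ Finset.range Q.length, ∏ c ∈ Finset.Icc 2 (Q.getD r 0 - 2 * (r + 1) + 1),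
    ((c : ℝ) ^ 2 - 1) / (c : ℝ) ^ 2

/-- The Murphy (Jucys–Murphy) operator M_r acting on functions. -/
noncomputable def murphy (r : ℕ) (f : Finset ℕ → ℝ) : Finset ℕ → ℝ :=
  fun U => ∑ i ∈ Finset.Icc 1 (r - 1), f (U.image (Equiv.swap i r))

/-- The state space as a finite type. -/
noncomputable def transpEndo (n a b : ℕ) :
    Module.End ℝ ((↥((Finset.Icc 1 n).powerset)) → ℝ) where
  toFun f U := f (if h : U.1.image (Equiv.swap a b) ∈ (Finset.Icc 1 n).powerset
    then ⟨U.1.image (Equiv.swap a b), h⟩ else U)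
  map_add' f g := rfl
  map_smul' c f := rfl

noncomputable def murphyEndo (n r : ℕ) :
    Module.End ℝ ((↥((Finset.Icc 1 n).powerset)) → ℝ) :=
  ∑ i ∈ Finset.Icc 1 (r - 1), transpEndo n i r

noncomputable def KEndo (n : ℕ) :
    Module.End ℝ ((↥((Finset.Icc 1 n).powerset)) → ℝ) where
  toFun f x := ∑ y : ↥((Finset.Icc 1 n).powerset), Kmat n x.1 y.1 * f y
  map_add' f g := by funext x; simp [mul_add, Finset.sum_add_distrib]
  map_smul' c f := by funext x; simp [Finset.mul_sum, mul_left_comm]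


open Polynomial in
/-- The polynomial whose coefficients are the products of central binomial coefficients
`centralBinom i * centralBinom (p - i)`; up to normalization it is a Legendre polynomial. -/
noncomputable def legendreSum (p : ℕ) : ℝ[X] :=
  ∑ x ∈ antidiagonal p, monomial x.1 ((x.1.centralBinom : ℝ) * x.2.centralBinom)

open Polynomial in
/-- The linear functional sending `X ^ k` to `(-1) ^ k * N.choose k`. -/
noncomputable def altChoose (N : ℕ) : ℝ[X] →ₗ[ℝ] ℝ :=
  Polynomial.lsum fun k => LinearMap.mulRight ℝ ((-1 : ℝ) ^ k * N.choose k)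

theorem altChoose_monomial (N k : ℕ) (a : ℝ) :
    altChoose N (Polynomial.monomial k a) = a * ((-1 : ℝ) ^ k * N.choose k) := by
  simp [altChoose, Polynomial.lsum_apply, Polynomial.sum_monomial_index, mul_assoc]

theorem succ_mul_centralBinom_succ_real (n : ℕ) :
    ((n : ℝ) + 1) * (n + 1).centralBinom = 2 * (2 * n + 1) * n.centralBinom := by
  exact_mod_cast Nat.succ_mul_centralBinom_succ n

open Polynomial in
theorem legendreSum_succ (p : ℕ) :
    C ((p : ℝ) + 1) * legendreSum (p + 1) =
      (C 2 * X + C (4 * (p : ℝ) + 2)) * legendreSum p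
        + C 4 * (X * (X - 1)) * derivative (legendreSum p) := by
  have key : C ((p : ℝ) + 1) * legendreSum (p + 1) =
      ∑ x ∈ antidiagonal (p + 1),
          monomial x.1 ((x.1 : ℝ) * ((x.1.centralBinom : ℝ) * x.2.centralBinom)) +
        ∑ x ∈ antidiagonal (p + 1),
          monomial x.1 ((x.2 : ℝ) * ((x.1.centralBinom : ℝ) * x.2.centralBinom)) := by
    rw [legendreSum, Finset.mul_sum, ← Finset.sum_add_distrib]
    refine Finset.sum_congr rfl fun x hx => ?_
    have h : (x.1 : ℝ) + x.2 = p + 1 := by exact_mod_cast HasAntidiagonal.mem_antidiagonal.mp hx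
    rw [← map_add, ← h, C_mul_monomial, add_mul]
  rw [key, Finset.Nat.sum_antidiagonal_succ, Finset.Nat.sum_antidiagonal_succ']
  simp only [Nat.cast_zero, zero_mul, map_zero, zero_add, legendreSum]
  rw [derivative_sum, Finset.mul_sum, Finset.mul_sum, ← Finset.sum_add_distrib,
    ← Finset.sum_add_distrib]
  refine Finset.sum_congr rfl fun x hx => ?_
  obtain ⟨i, j⟩ := x
  have h : (i : ℝ) + j = p := by exact_mod_cast HasAntidiagonal.mem_antidiagonal.mp hx
  have hi := succ_mul_centralBinom_succ_real i
  have hj := succ_mul_centralBinom_succ_real j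
  have e1 : (((i + 1 : ℕ) : ℝ) * (((i + 1).centralBinom : ℝ) * j.centralBinom)) =
      (4 * i + 2) * (i.centralBinom * j.centralBinom) := by
    push_cast; linear_combination (j.centralBinom : ℝ) * hi
  have e2 : (((j + 1 : ℕ) : ℝ) * ((i.centralBinom : ℝ) * (j + 1).centralBinom)) =
      (4 * j + 2) * (i.centralBinom * j.centralBinom) := by
    push_cast; linear_combination (i.centralBinom : ℝ) * hj
  have hder : X * derivative (monomial i ((i.centralBinom : ℝ) * j.centralBinom)) =
      C (i : ℝ) * monomial i ((i.centralBinom : ℝ) * j.centralBinom) := by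
    rw [derivative_monomial, C_mul_monomial]
    cases i with
    | zero => simp
    | succ i => rw [X_mul_monomial]; simp; ring_nf
  have hm : monomial (i + 1) ((4 * (i : ℝ) + 2) * (i.centralBinom * j.centralBinom)) =
      C (4 * (i : ℝ) + 2) * (X * monomial i ((i.centralBinom : ℝ) * j.centralBinom)) := by
    rw [X_mul_monomial, C_mul_monomial]
  simp only [e1, e2]
  have hm' : monomial i ((4 * (j : ℝ) + 2) * (i.centralBinom * j.centralBinom)) =
      C (4 * (j : ℝ) + 2) * monomial i ((i.centralBinom : ℝ) * j.centralBinom) := by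
    rw [C_mul_monomial]
  rw [hm, hm', ← h]
  generalize monomial i ((i.centralBinom : ℝ) * j.centralBinom) = M at hder ⊢
  simp only [map_add, map_mul]
  linear_combination (- C 4 * (X - 1)) * hder

open Polynomial in
theorem altChoose_exact (N : ℕ) (F : ℝ[X]) :
    altChoose N (X * (X - 1) * derivative F + (X + C (N : ℝ)) * F) = 0 := by
  induction F using Polynomial.induction_on' with
  | add f g hf hg =>
    rw [← add_zero (0 : ℝ)]
    nth_rw 1 [← hf, ← hg]
    rw [← map_add, derivative_add]
    congr 1
    ring
  | monomial k a =>
    have hder : X * derivative (monomial k a) = C (k : ℝ) * monomial k a := by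
      rw [derivative_monomial, C_mul_monomial]
      cases k with
      | zero => simp
      | succ i => rw [X_mul_monomial]; simp; ring_nf
    have e : X * (X - 1) * derivative (monomial k a) + (X + C (N : ℝ)) * monomial k a =
        monomial (k + 1) (((k : ℝ) + 1) * a) + monomial k (((N : ℝ) - k) * a) := by
      rw [← C_mul_monomial, ← C_mul_monomial, ← X_mul_monomial]
      simp only [map_add, map_sub, map_one]
      linear_combination (X - 1) * hder
    rw [e, map_add, altChoose_monomial, altChoose_monomial]
    have hc : ((k : ℝ) + 1) * N.choose (k + 1) = (N - k) * N.choose k := by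
      rcases le_or_gt k N with h | h
      · have := Nat.choose_succ_right_eq N k
        rw [← Nat.cast_sub h, mul_comm, mul_comm _ (N.choose k : ℝ)]
        exact_mod_cast this
      · simp [Nat.choose_eq_zero_of_lt h, Nat.choose_eq_zero_of_lt (Nat.lt_succ_of_lt h)]
    rw [pow_succ]
    linear_combination (-a * (-1) ^ k) * hc

/-- The alternating pairing of two Legendre polynomials. -/
noncomputable def legendrePairing (p q : ℕ) : ℝ :=
  altChoose (p + q) (legendreSum p * legendreSum q)

theorem legendrePairing_eq_sum (p q : ℕ) :
    legendrePairing p q = ∑ x ∈ antidiagonal p, ∑ y ∈ antidiagonal q,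
      ((x.1.centralBinom : ℝ) * x.2.centralBinom) * (y.1.centralBinom * y.2.centralBinom) *
        ((-1) ^ (x.1 + y.1) * (p + q).choose (x.1 + y.1)) := by
  simp only [legendrePairing, legendreSum, Finset.sum_mul_sum, map_sum,
    Polynomial.monomial_mul_monomial, altChoose_monomial]

open Polynomial in
theorem legendrePairing_succ (p q : ℕ) :
    ((p : ℝ) + 1) * legendrePairing (p + 1) q = -((q + 1) * legendrePairing p (q + 1)) := by
  have h := altChoose_exact (p + q + 1) (C 4 * (legendreSum p * legendreSum q))
  have e : X * (X - 1) * derivative (C 4 * (legendreSum p * legendreSum q)) +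
      (X + C (((p + q + 1 : ℕ) : ℝ))) * (C 4 * (legendreSum p * legendreSum q)) =
      ((p : ℝ) + 1) • (legendreSum (p + 1) * legendreSum q) +
        ((q : ℝ) + 1) • (legendreSum p * legendreSum (q + 1)) := by
    rw [smul_eq_C_mul, smul_eq_C_mul, derivative_C_mul, derivative_mul]
    have hp := legendreSum_succ p
    have hq := legendreSum_succ q
    have h4 : (C 4 : ℝ[X]) = C 2 * C 2 := by rw [← C_mul]; norm_num
    have h2 : (C 2 : ℝ[X]) = 2 := rfl
    simp only [Nat.cast_add, Nat.cast_one, map_add, map_mul, map_one, h4, h2] at hp hq ⊢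
    linear_combination (-legendreSum q) * hp - legendreSum p * hq
  rw [e, map_add, map_smul, map_smul, smul_eq_mul, smul_eq_mul] at h
  rw [legendrePairing, legendrePairing, show p + 1 + q = p + q + 1 by ring,
    show p + (q + 1) = p + q + 1 by ring]
  linarith

theorem legendrePairing_eq (p q : ℕ) :
    legendrePairing p q = (-1) ^ p * (p + q).choose p * legendrePairing 0 (p + q) := by
  induction p generalizing q with
  | zero => simp
  | succ p ih =>
    have h := legendrePairing_succ p q
    rw [ih (q + 1), show p + (q + 1) = p + 1 + q by ring] at h
    have hc : ((p + 1 + q).choose (p + 1) : ℝ) * (p + 1) =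
        (p + 1 + q).choose p * (q + 1) := by
      have := Nat.choose_succ_right_eq (p + 1 + q) p
      rw [show p + 1 + q - p = q + 1 by omega] at this
      exact_mod_cast this
    have hp : (p : ℝ) + 1 ≠ 0 := by positivity
    apply mul_left_cancel₀ hp
    rw [h, pow_succ]
    linear_combination (-1) ^ p * legendrePairing 0 (p + 1 + q) * hc

/-- The alternating self-convolution of the sequence `centralBinom i / i!`. -/
noncomputable def altConv (N : ℕ) : ℝ :=
  ∑ x ∈ antidiagonal N, (-1) ^ x.1 * ((x.1.centralBinom : ℝ) / x.1.factorial) *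
    (x.2.centralBinom / x.2.factorial)

theorem legendrePairing_zero_left (N : ℕ) :
    legendrePairing 0 N = N.factorial * altConv N := by
  rw [legendrePairing_eq_sum, altConv, Finset.mul_sum]
  simp only [Finset.Nat.antidiagonal_zero, Finset.sum_singleton]
  refine Finset.sum_congr rfl fun x hx => ?_
  obtain ⟨i, j⟩ := x
  obtain rfl : i + j = N := HasAntidiagonal.mem_antidiagonal.mp hx
  simp only [zero_add, Nat.centralBinom_zero, Nat.cast_one, one_mul]
  rw [Nat.cast_add_choose]
  ring

theorem sq_mul_centralBinom_div_factorial_succ (i : ℕ) :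
    ((i : ℝ) + 1) ^ 2 * ((i + 1).centralBinom / (i + 1).factorial) =
      (4 * i + 2) * (i.centralBinom / i.factorial) := by
  have h := succ_mul_centralBinom_succ_real i
  have hf : (i.factorial : ℝ) ≠ 0 := by positivity
  have hi : (i : ℝ) + 1 ≠ 0 := by positivity
  rw [Nat.factorial_succ]
  push_cast
  field_simp
  linear_combination h

theorem sum_antidiagonal_sq_fst (N : ℕ) (f : ℕ → ℕ → ℝ) :
    ∑ x ∈ antidiagonal (N + 1), (x.1 : ℝ) ^ 2 * f x.1 x.2 *
        ((-1) ^ x.1 * ((x.1.centralBinom : ℝ) / x.1.factorial) *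
          (x.2.centralBinom / x.2.factorial)) =
      - ∑ x ∈ antidiagonal N, (4 * x.1 + 2) * f (x.1 + 1) x.2 *
        ((-1) ^ x.1 * ((x.1.centralBinom : ℝ) / x.1.factorial) *
          (x.2.centralBinom / x.2.factorial)) := by
  rw [Finset.Nat.sum_antidiagonal_succ, ← Finset.sum_neg_distrib]
  simp only [Nat.cast_zero, ne_eq, OfNat.ofNat_ne_zero, not_false_eq_true, zero_pow, zero_mul,
    zero_add]
  refine Finset.sum_congr rfl fun x _ => ?_
  have h := sq_mul_centralBinom_div_factorial_succ x.1
  push_cast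
  rw [pow_succ (-1 : ℝ)]
  linear_combination (-f (x.1 + 1) x.2 * (-1) ^ x.1 * (x.2.centralBinom / x.2.factorial)) * h

theorem sum_antidiagonal_sq_snd (N : ℕ) (f : ℕ → ℕ → ℝ) :
    ∑ x ∈ antidiagonal (N + 1), (x.2 : ℝ) ^ 2 * f x.1 x.2 *
        ((-1) ^ x.1 * ((x.1.centralBinom : ℝ) / x.1.factorial) *
          (x.2.centralBinom / x.2.factorial)) =
      ∑ x ∈ antidiagonal N, (4 * x.2 + 2) * f x.1 (x.2 + 1) *
        ((-1) ^ x.1 * ((x.1.centralBinom : ℝ) / x.1.factorial) *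
          (x.2.centralBinom / x.2.factorial)) := by
  rw [Finset.Nat.sum_antidiagonal_succ']
  simp only [Nat.cast_zero, ne_eq, OfNat.ofNat_ne_zero, not_false_eq_true, zero_pow, zero_mul,
    zero_add]
  refine Finset.sum_congr rfl fun x _ => ?_
  have h := sq_mul_centralBinom_div_factorial_succ x.2
  push_cast
  linear_combination (f x.1 (x.2 + 1) * (-1) ^ x.1 * (x.1.centralBinom / x.1.factorial)) * h

theorem altConv_add_two (N : ℕ) :
    ((N : ℝ) + 2) ^ 3 * altConv (N + 2) = 16 * (N + 1) * altConv N := by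
  have h1 := sum_antidiagonal_sq_fst (N + 1) fun i j => (i : ℝ) + 3 * j
  have h2 := sum_antidiagonal_sq_snd (N + 1) fun i j => (j : ℝ) + 3 * i
  have h3 := sum_antidiagonal_sq_fst N fun _ _ => 4
  have h4 := sum_antidiagonal_sq_snd N fun _ _ => 4
  refine Eq.trans ?_ ((congrArg₂ HAdd.hAdd h1 h2).trans ?_)
  · rw [altConv, Finset.mul_sum, ← Finset.sum_add_distrib]
    refine Finset.sum_congr rfl fun x hx => ?_
    have h : (x.1 : ℝ) + x.2 = N + 2 := by
      exact_mod_cast HasAntidiagonal.mem_antidiagonal.mp hx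
    rw [← h]
    ring
  · refine Eq.trans ?_ ((congrArg₂ HSub.hSub h4 h3).trans ?_)
    · rw [← Finset.sum_neg_distrib, ← Finset.sum_add_distrib, ← Finset.sum_sub_distrib]
      refine Finset.sum_congr rfl fun x _ => ?_
      push_cast
      ring
    · rw [altConv, Finset.mul_sum, sub_neg_eq_add, ← Finset.sum_add_distrib]
      refine Finset.sum_congr rfl fun x hx => ?_
      have h : (x.1 : ℝ) + x.2 = N := by
        exact_mod_cast HasAntidiagonal.mem_antidiagonal.mp hx
      rw [← h]
      ring

theorem altConv_odd (k : ℕ) : altConv (2 * k + 1) = 0 := by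
  induction k with
  | zero => simp [altConv, Finset.Nat.antidiagonal_succ]
  | succ k ih =>
    have h := altConv_add_two (2 * k + 1)
    rw [ih, mul_zero] at h
    exact (mul_eq_zero.mp h).resolve_left (by positivity)

theorem altConv_even (k : ℕ) :
    (2 * k).factorial * altConv (2 * k) = (k.centralBinom : ℝ) ^ 2 := by
  induction k with
  | zero => simp [altConv]
  | succ k ih =>
    have h := altConv_add_two (2 * k)
    have hc := succ_mul_centralBinom_succ_real k
    have hk : ((k : ℝ) + 1) ^ 2 ≠ 0 := by positivity
    rw [show 2 * (k + 1) = 2 * k + 2 by ring, Nat.factorial_succ, Nat.factorial_succ]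
    push_cast at h ⊢
    apply mul_left_cancel₀ hk
    have h' : ((k : ℝ) + 1) ^ 2 * ((2 * k + 1 + 1) * altConv (2 * k + 2)) =
        4 * (2 * k + 1) * altConv (2 * k) := by
      linear_combination h / 4
    linear_combination ((2 * (k : ℝ) + 1) * (2 * k).factorial) * h' +
      4 * (2 * (k : ℝ) + 1) ^ 2 * ih -
      (((k : ℝ) + 1) * (k + 1).centralBinom + 2 * (2 * k + 1) * k.centralBinom) * hc

/-- The beta-binomial (arcsine) weight of a pattern with `j` successes and `k` failures. -/
noncomputable def arcsineWeight (j k : ℕ) : ℝ :=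
  (j.centralBinom : ℝ) * k.centralBinom / (4 ^ (j + k) * (j + k).choose j)

theorem arcsineWeight_add (j k : ℕ) :
    arcsineWeight j (k + 1) + arcsineWeight (j + 1) k = arcsineWeight j k := by
  have hj := succ_mul_centralBinom_succ_real j
  have hk := succ_mul_centralBinom_succ_real k
  have hj0 : (j : ℝ) + 1 ≠ 0 := by positivity
  have hk0 : (k : ℝ) + 1 ≠ 0 := by positivity
  have hjf : (j.factorial : ℝ) ≠ 0 := by positivity
  have hkf : (k.factorial : ℝ) ≠ 0 := by positivity
  have hjkf : ((j + k).factorial : ℝ) ≠ 0 := by positivity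
  have hjk0 : (j : ℝ) + k + 1 ≠ 0 := by positivity
  simp only [arcsineWeight, Nat.cast_add_choose]
  rw [show j + 1 + k = j + k + 1 by ring, ← add_assoc, Nat.factorial_succ, Nat.factorial_succ,
    Nat.factorial_succ, pow_succ]
  push_cast
  field_simp
  linear_combination (j.centralBinom : ℝ) * hk + (k.centralBinom : ℝ) * hj

theorem sum_powerset_disjUnion {A B : Finset ℕ} (h : Disjoint A B) (f : Finset ℕ → ℝ) :
    ∑ y ∈ (A ∪ B).powerset, f y = ∑ y ∈ A.powerset, ∑ z ∈ B.powerset, f (y ∪ z) := by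
  induction B using Finset.induction_on generalizing f with
  | empty => simp
  | insert e B he ih =>
    have hd : Disjoint A B := Finset.disjoint_of_subset_right (Finset.subset_insert e B) h
    have heA : e ∉ A := fun hA => Finset.disjoint_left.mp h hA (Finset.mem_insert_self e B)
    rw [Finset.union_insert, Finset.sum_powerset_insert (by simp [heA, he]), ih hd, ih hd,
      ← Finset.sum_add_distrib]
    refine Finset.sum_congr rfl fun y _ => ?_
    rw [Finset.sum_powerset_insert he]
    simp [Finset.union_insert]

theorem sum_arcsineWeight_union {A B : Finset ℕ} (h : Disjoint A B) (f : Finset ℕ → ℝ) :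
    ∑ y ∈ (A ∪ B).powerset, arcsineWeight y.card ((A ∪ B) \ y).card * f (y ∩ A) =
      ∑ y ∈ A.powerset, arcsineWeight y.card (A \ y).card * f y := by
  induction B using Finset.induction_on with
  | empty =>
    rw [Finset.union_empty]
    refine Finset.sum_congr rfl fun y hy => ?_
    rw [Finset.inter_eq_left.mpr (Finset.mem_powerset.mp hy)]
  | insert e B he ih =>
    have hd : Disjoint A B := Finset.disjoint_of_subset_right (Finset.subset_insert e B) h
    have heA : e ∉ A := fun hA => Finset.disjoint_left.mp h hA (Finset.mem_insert_self e B)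
    have heAB : e ∉ A ∪ B := by simp [heA, he]
    rw [Finset.union_insert, Finset.sum_powerset_insert heAB, ← ih hd, ← Finset.sum_add_distrib]
    refine Finset.sum_congr rfl fun y hy => ?_
    have hey : e ∉ y := fun h' => heAB (Finset.mem_powerset.mp hy h')
    rw [Finset.insert_sdiff_insert, Finset.insert_inter_of_notMem heA,
      Finset.insert_sdiff_of_notMem _ hey, Finset.sdiff_insert_of_notMem heAB,
      Finset.card_insert_of_notMem hey, Finset.card_insert_of_notMem (by simp [heA, he]),
      ← arcsineWeight_add y.card ((A ∪ B) \ y).card]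
    ring

theorem sum_arcsineWeight_powerset (A : Finset ℕ) (g : ℕ → ℝ) :
    ∑ y ∈ A.powerset, arcsineWeight y.card (A \ y).card * g y.card =
      ∑ x ∈ antidiagonal A.card,
        ((x.1.centralBinom : ℝ) * x.2.centralBinom / 4 ^ A.card) * g x.1 := by
  have h : ∑ y ∈ A.powerset, arcsineWeight y.card (A \ y).card * g y.card =
      ∑ y ∈ A.powerset, (fun j => arcsineWeight j (A.card - j) * g j) y.card := by
    refine Finset.sum_congr rfl fun y hy => ?_
    rw [Finset.card_sdiff_of_subset (Finset.mem_powerset.mp hy)]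
  refine h.trans ((Finset.sum_powerset_apply_card
    (fun j => arcsineWeight j (A.card - j) * g j)).trans ?_)
  rw [Finset.Nat.sum_antidiagonal_eq_sum_range_succ_mk]
  refine Finset.sum_congr rfl fun j hj => ?_
  have hj' : j ≤ A.card := Nat.lt_succ_iff.mp (Finset.mem_range.mp hj)
  have hc : (A.card.choose j : ℝ) ≠ 0 := by exact_mod_cast (Nat.choose_pos hj').ne'
  rw [arcsineWeight, Nat.add_sub_of_le hj', nsmul_eq_mul]
  field_simp

theorem sum_arcsineWeight_inter (A S : Finset ℕ) (g : ℕ → ℝ) :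
    ∑ y ∈ A.powerset, arcsineWeight y.card (A \ y).card * g (S ∩ y).card =
      ∑ x ∈ antidiagonal (S ∩ A).card,
        ((x.1.centralBinom : ℝ) * x.2.centralBinom / 4 ^ (S ∩ A).card) * g x.1 := by
  have hu : (S ∩ A) ∪ (A \ S) = A := by
    rw [Finset.inter_comm, Finset.union_comm, Finset.sdiff_union_inter]
  have hd : Disjoint (S ∩ A) (A \ S) := Finset.disjoint_of_subset_left Finset.inter_subset_left
    Finset.disjoint_sdiff
  have h := sum_arcsineWeight_union hd fun y => g y.card
  rw [hu, sum_arcsineWeight_powerset] at h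
  rw [← h]
  refine Finset.sum_congr rfl fun y hy => ?_
  have : y ∩ (S ∩ A) = S ∩ y := by
    have := Finset.mem_powerset.mp hy
    ext a
    simp only [Finset.mem_inter]
    exact ⟨fun h => ⟨h.2.1, h.1⟩, fun h => ⟨h.2, h.1, this h.2⟩⟩
  rw [this]

theorem Kmat_union {n : ℕ} {x y z : Finset ℕ} (hx : x ⊆ Icc 1 n) (hy : y ⊆ x)
    (hz : z ⊆ Icc 1 n \ x) :
    Kmat n x (y ∪ z) =
      arcsineWeight y.card (x \ y).card *
        arcsineWeight z.card ((Icc 1 n \ x) \ z).card := by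
  have hdz : Disjoint x z := Finset.disjoint_of_subset_right hz Finset.disjoint_sdiff
  have h1 : (y ∪ z) \ x = z := by
    rw [Finset.union_sdiff_distrib, Finset.sdiff_eq_empty_iff_subset.mpr hy, Finset.empty_union,
      Finset.sdiff_eq_self_of_disjoint hdz.symm]
  have h2 : x \ (y ∪ z) = x \ y := by
    rw [← Finset.sup_eq_union, ← sdiff_sdiff, Finset.sdiff_eq_self_of_disjoint]
    exact hdz.mono_left Finset.sdiff_subset
  have h3 : x ∩ (y ∪ z) = y := by
    rw [Finset.inter_union_distrib_left, Finset.inter_eq_right.mpr hy,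
      Finset.disjoint_iff_inter_eq_empty.mp hdz, Finset.union_empty]
  have h4 : x ∪ (y ∪ z) = x ∪ z := by
    rw [← Finset.union_assoc, Finset.union_eq_left.mpr hy]
  have c1 : (x \ y).card + y.card = x.card := Finset.card_sdiff_add_card_eq_card hy
  have c2 : ((Icc 1 n \ x) \ z).card + z.card = (Icc 1 n \ x).card :=
    Finset.card_sdiff_add_card_eq_card hz
  have c3 : (Icc 1 n \ x).card + x.card = n := by
    rw [Finset.card_sdiff_add_card_eq_card hx]; simp
  have c4 : n - (x ∪ (y ∪ z)).card = ((Icc 1 n \ x) \ z).card := by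
    rw [h4, Finset.card_union_of_disjoint hdz]
    omega
  rw [Kmat, c4, h1, h2, h3, arcsineWeight, arcsineWeight]
  simp only [← Nat.centralBinom_eq_two_mul_choose]
  generalize ((Icc 1 n \ x) \ z).card = d at *
  generalize (x \ y).card = b at *
  have hn : n = (y.card + b) + (z.card + d) := by omega
  rw [hn, pow_add, Nat.add_comm d, Nat.add_comm b, Nat.choose_symm_add,
    ← Nat.choose_symm_add (a := z.card)]
  field_simp

/-- `f` satisfies the eigenvalue equation of `K_n` with eigenvalue `c` on subsets of `{1,…,n}`. -/
def IsKEigen (n : ℕ) (c : ℝ) (f : Finset ℕ → ℝ) : Prop :=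
  ∀ U ⊆ Icc 1 n, Kop n f U = c * f U

/-- The eigenvalue of `K_n` on `f_S` with `#S = N`. -/
noncomputable def burnsideEigenvalue (N : ℕ) : ℝ := legendrePairing 0 N / 4 ^ N

theorem burnsideEigenvalue_even (k : ℕ) : burnsideEigenvalue (2 * k) = betaEV k := by
  rw [burnsideEigenvalue, legendrePairing_zero_left, altConv_even, betaEV,
    Nat.centralBinom_eq_two_mul_choose, pow_mul]
  norm_num

theorem burnsideEigenvalue_odd {N : ℕ} (h : Odd N) : burnsideEigenvalue N = 0 := by
  obtain ⟨k, rfl⟩ := h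
  rw [burnsideEigenvalue, legendrePairing_zero_left, altConv_odd, mul_zero, zero_div]

theorem isKEigen_fSvec {n : ℕ} {S : Finset ℕ} (hS : S ⊆ Icc 1 n) :
    IsKEigen n (burnsideEigenvalue S.card) (fSvec S) := by
  intro x hx
  have hu : x ∪ (Icc 1 n \ x) = Icc 1 n := Finset.union_sdiff_of_subset hx
  have hcard : (S ∩ x).card + (S ∩ (Icc 1 n \ x)).card = S.card := by
    rw [← Finset.card_union_of_disjoint, ← Finset.inter_union_distrib_left, hu,
      Finset.inter_eq_left.mpr hS]
    exact (Finset.disjoint_sdiff.mono_left Finset.inter_subset_right).mono_right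
      Finset.inter_subset_right
  set p := (S ∩ x).card with hp
  set q := (S ∩ (Icc 1 n \ x)).card with hq
  let F : ℕ → ℕ → ℝ := fun i j => (-1 : ℝ) ^ (i + j) * S.card.choose (i + j)
  let G : ℕ → ℝ := fun i => ∑ z ∈ (Icc 1 n \ x).powerset,
    arcsineWeight z.card ((Icc 1 n \ x) \ z).card * F i (S ∩ z).card
  have h1 : Kop n (fSvec S) x = ∑ y ∈ x.powerset, arcsineWeight y.card (x \ y).card *
      G (S ∩ y).card := by
    rw [Kop]
    nth_rw 1 [← hu]
    rw [sum_powerset_disjUnion Finset.disjoint_sdiff]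
    refine Finset.sum_congr rfl fun y hy => ?_
    rw [Finset.mul_sum]
    refine Finset.sum_congr rfl fun z hz => ?_
    have hy' := Finset.mem_powerset.mp hy
    have hz' := Finset.mem_powerset.mp hz
    have hd : Disjoint (S ∩ y) (S ∩ z) :=
      ((Finset.disjoint_sdiff (s := x) (t := Icc 1 n)).mono hy' hz').mono
        Finset.inter_subset_right Finset.inter_subset_right
    rw [Kmat_union hx hy' hz', fSvec, Finset.inter_union_distrib_left,
      Finset.card_union_of_disjoint hd, mul_assoc]
  refine h1.trans ((sum_arcsineWeight_inter x S G).trans ?_)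
  rw [← hp]
  refine (Finset.sum_congr rfl fun i _ => congrArg _
    (sum_arcsineWeight_inter (Icc 1 n \ x) S (F i.1))).trans ?_
  rw [← hq]
  have h2 := legendrePairing_eq p q
  rw [legendrePairing_eq_sum] at h2
  rw [fSvec, burnsideEigenvalue, ← hp, ← hcard]
  have e : legendrePairing 0 (p + q) / 4 ^ (p + q) * ((-1) ^ p * ((p + q).choose p : ℝ)) =
      ((-1) ^ p * (p + q).choose p * legendrePairing 0 (p + q)) / 4 ^ (p + q) := by ring
  rw [e, ← h2, Finset.sum_div]
  refine Finset.sum_congr rfl fun x _ => ?_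
  rw [Finset.mul_sum, Finset.sum_div]
  refine Finset.sum_congr rfl fun y _ => ?_
  have hF : F x.1 y.1 = (-1) ^ (x.1 + y.1) * (p + q).choose (x.1 + y.1) := by rw [hcard]
  rw [hF, pow_add 4]
  field_simp

theorem image_swap_subset {n t : ℕ} (ht : 1 ≤ t) (htn : t + 1 ≤ n) {U : Finset ℕ}
    (hU : U ⊆ Icc 1 n) : U.image (Equiv.swap t (t + 1)) ⊆ Icc 1 n := by
  intro a ha
  obtain ⟨b, hb, rfl⟩ := Finset.mem_image.mp ha
  have hb' := Finset.mem_Icc.mp (hU hb)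
  rw [Finset.mem_Icc, Equiv.swap_apply_def]
  split_ifs <;> omega

theorem image_swap_image_swap (t : ℕ) (U : Finset ℕ) :
    (U.image (Equiv.swap t (t + 1))).image (Equiv.swap t (t + 1)) = U := by
  rw [Finset.image_image]
  simp [Function.comp_def]

theorem Kmat_image (n : ℕ) (e : Equiv.Perm ℕ) (x y : Finset ℕ) :
    Kmat n (x.image e) (y.image e) = Kmat n x y := by
  simp only [Kmat, ← Finset.image_union, ← Finset.image_inter _ _ e.injective,
    ← Finset.image_sdiff _ _ e.injective, Finset.card_image_of_injective _ e.injective]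

namespace IsKEigen

variable {n : ℕ} {c : ℝ} {f g : Finset ℕ → ℝ}

theorem sub (hf : IsKEigen n c f) (hg : IsKEigen n c g) :
    IsKEigen n c fun U => f U - g U := by
  intro U hU
  have h1 := hf U hU
  have h2 := hg U hU
  simp only [Kop] at h1 h2 ⊢
  simp only [mul_sub, Finset.sum_sub_distrib, h1, h2]

theorem const_mul (a : ℝ) (hf : IsKEigen n c f) : IsKEigen n c fun U => a * f U := by
  intro U hU
  have h := hf U hU
  simp only [Kop] at h ⊢
  simp only [mul_left_comm _ a, ← Finset.mul_sum, h]

theorem sum {ι : Type*} {s : Finset ι} {F : ι → Finset ℕ → ℝ}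
    (hF : ∀ i ∈ s, IsKEigen n c (F i)) : IsKEigen n c fun U => ∑ i ∈ s, F i U := by
  intro U hU
  simp only [Kop, Finset.mul_sum]
  rw [Finset.sum_comm]
  refine Finset.sum_congr rfl fun i hi => ?_
  exact hF i hi U hU

theorem congr (hf : IsKEigen n c f) (h : ∀ U ⊆ Icc 1 n, g U = f U) : IsKEigen n c g := by
  intro U hU
  rw [h U hU, ← hf U hU]
  refine Finset.sum_congr rfl fun y hy => ?_
  rw [h y (Finset.mem_powerset.mp hy)]

theorem sOp {t : ℕ} (ht : 1 ≤ t) (htn : t + 1 ≤ n) (hf : IsKEigen n c f) :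
    IsKEigen n c (sOp t f) := by
  intro U hU
  rw [_root_.sOp, ← hf _ (image_swap_subset ht htn hU)]
  simp only [Kop, _root_.sOp]
  refine Finset.sum_nbij' (fun y => y.image (Equiv.swap t (t + 1)))
    (fun y => y.image (Equiv.swap t (t + 1))) ?_ ?_ ?_ ?_ ?_
  · exact fun y hy => Finset.mem_powerset.mpr
      (image_swap_subset ht htn (Finset.mem_powerset.mp hy))
  · exact fun y hy => Finset.mem_powerset.mpr
      (image_swap_subset ht htn (Finset.mem_powerset.mp hy))
  · exact fun y _ => image_swap_image_swap t y
  · exact fun y _ => image_swap_image_swap t y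
  · exact fun y _ => by rw [Kmat_image]

theorem tauComp {r k : ℕ} (hr : 1 ≤ r) (hk : k = 0 ∨ 2 * r + k ≤ n) (hf : IsKEigen n c f) :
    IsKEigen n c (tauComp r k f) := by
  induction k with
  | zero => exact hf
  | succ k ih =>
    have ih := ih (by omega)
    exact (ih.sOp (by omega) (by omega)).sub (ih.const_mul _)

theorem tauQAux {r : ℕ} (hr : 1 ≤ r) {Q : List ℕ} (hQ : ∀ a ∈ Q, a ≤ n) (hf : IsKEigen n c f) :
    IsKEigen n c (tauQAux r Q f) := by
  induction Q generalizing r with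
  | nil => exact hf
  | cons a Q ih =>
    have ha := hQ a List.mem_cons_self
    exact (ih (by omega) fun b hb => hQ b (List.mem_cons_of_mem a hb)).tauComp hr (by omega)

end IsKEigen

theorem exists_tauFactor_ne_zero {n r k : ℕ} (hr : 1 ≤ r) (hk : 2 * r + k + 1 ≤ n)
    {f : Finset ℕ → ℝ} (hf : ∃ U ⊆ Icc 1 n, f U ≠ 0) :
    ∃ U ⊆ Icc 1 n, tauFactor r (2 * r + k) f U ≠ 0 := by
  by_contra! h
  obtain ⟨U, hU, hfU⟩ := hf
  apply hfU
  have h1 := h U hU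
  have h2 := h _ (image_swap_subset (by omega) hk hU)
  simp only [tauFactor, sOp, image_swap_image_swap] at h1 h2
  have hc : (((2 * r + k : ℕ) : ℝ) - 2 * r + 2)⁻¹ ^ 2 < 1 := by
    have e : ((2 * r + k : ℕ) : ℝ) - 2 * r + 2 = k + 2 := by push_cast; ring
    rw [e, inv_pow]
    apply inv_lt_one_of_one_lt₀
    have : (0 : ℝ) ≤ k := by positivity
    nlinarith
  generalize (((2 * r + k : ℕ) : ℝ) - 2 * r + 2)⁻¹ = d at *
  have h3 : (1 - d ^ 2) * f U = 0 := by linear_combination h2 + d * h1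
  exact (mul_eq_zero.mp h3).resolve_left (by linarith)

theorem exists_tauComp_ne_zero {n r k : ℕ} (hr : 1 ≤ r) (hk : k = 0 ∨ 2 * r + k ≤ n)
    {f : Finset ℕ → ℝ} (hf : ∃ U ⊆ Icc 1 n, f U ≠ 0) :
    ∃ U ⊆ Icc 1 n, tauComp r k f U ≠ 0 := by
  induction k with
  | zero => exact hf
  | succ k ih => exact exists_tauFactor_ne_zero hr (by omega) (ih (by omega))

theorem exists_tauQAux_ne_zero {n r : ℕ} (hr : 1 ≤ r) {Q : List ℕ} (hQ : ∀ a ∈ Q, a ≤ n)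
    {f : Finset ℕ → ℝ} (hf : ∃ U ⊆ Icc 1 n, f U ≠ 0) :
    ∃ U ⊆ Icc 1 n, tauQAux r Q f U ≠ 0 := by
  induction Q generalizing r with
  | nil => exact hf
  | cons a Q ih =>
    have ha := hQ a List.mem_cons_self
    exact exists_tauComp_ne_zero hr (by omega)
      (ih (by omega) fun b hb => hQ b (List.mem_cons_of_mem a hb))

/-- The product over the columns `{2r+1, 2r+2}` of the difference of their indicators. -/
noncomputable def pairSign (k : ℕ) (U : Finset ℕ) : ℝ :=
  ∏ r ∈ Finset.range k, ((if 2 * r + 2 ∈ U then 1 else 0) - if 2 * r + 1 ∈ U then 1 else 0)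

/-- The antisymmetrization of `f_S` over the first `k` columns, where `S` consists of `W` and one
element of each of these columns. -/
noncomputable def pairVec (k : ℕ) (W U : Finset ℕ) : ℝ :=
  pairSign k U * ((-1) ^ (W ∩ U).card * (W.card + 2 * k).choose ((W ∩ U).card + k))

theorem card_insert_inter {a : ℕ} {W U : Finset ℕ} (ha : a ∉ W) :
    (insert a W ∩ U).card = (W ∩ U).card + if a ∈ U then 1 else 0 := by
  split_ifs with h
  · rw [Finset.insert_inter_of_mem h, Finset.card_insert_of_notMem]
    exact fun h' => ha (Finset.mem_inter.mp h').1
  · rw [Finset.insert_inter_of_notMem h, add_zero]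

theorem pairVec_succ {k : ℕ} {W : Finset ℕ} (h1 : 2 * k + 1 ∉ W) (h2 : 2 * k + 2 ∉ W)
    (U : Finset ℕ) :
    pairVec (k + 1) W U =
      pairVec k (insert (2 * k + 1) W) U - pairVec k (insert (2 * k + 2) W) U := by
  simp only [pairVec, card_insert_inter h1, card_insert_inter h2,
    Finset.card_insert_of_notMem h1, Finset.card_insert_of_notMem h2, pairSign,
    Finset.prod_range_succ]
  have hc : (((W.card + 2 * (k + 1)).choose ((W ∩ U).card + (k + 1)) : ℕ) : ℝ) =
      (W.card + 1 + 2 * k).choose ((W ∩ U).card + k) +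
        (W.card + 1 + 2 * k).choose ((W ∩ U).card + 1 + k) := by
    rw [show W.card + 2 * (k + 1) = W.card + 1 + 2 * k + 1 by ring,
      show (W ∩ U).card + (k + 1) = (W ∩ U).card + k + 1 by ring, Nat.choose_succ_succ,
      show (W ∩ U).card + 1 + k = (W ∩ U).card + k + 1 by ring]
    push_cast
    rfl
  rw [hc]
  split_ifs <;> simp only [add_zero, pow_succ] <;> ring

theorem isKEigen_pairVec {n k : ℕ} (hk : 2 * k ≤ n) {W : Finset ℕ} (hW : W ⊆ Icc (2 * k + 1) n) :
    IsKEigen n (burnsideEigenvalue (W.card + k)) (pairVec k W) := by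
  induction k generalizing W with
  | zero =>
    refine (isKEigen_fSvec hW).congr fun U _ => ?_
    simp [pairVec, pairSign, fSvec]
  | succ k ih =>
    have hn (a : ℕ) (ha : a ≤ 2 * k + 2) : a ∉ W := fun h => by
      have := Finset.mem_Icc.mp (hW h)
      omega
    have hins (a : ℕ) (ha : 2 * k + 1 ≤ a) (han : a ≤ n) :
        insert a W ⊆ Icc (2 * k + 1) n := by
      refine Finset.insert_subset (Finset.mem_Icc.mpr ⟨ha, han⟩) (hW.trans ?_)
      exact Finset.Icc_subset_Icc_left (by omega)
    have h1 := ih (by omega) (hins (2 * k + 1) (by omega) (by omega))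
    have h2 := ih (by omega) (hins (2 * k + 2) (by omega) (by omega))
    rw [Finset.card_insert_of_notMem (hn _ (by omega)), add_assoc, add_comm 1 k] at h1 h2
    exact (h1.sub h2).congr fun U _ => pairVec_succ (hn _ (by omega)) (hn _ (by omega)) U

theorem sum_powersetCard_inter (X U : Finset ℕ) (ℓ : ℕ) (g : ℕ → ℝ) :
    ∑ W ∈ Finset.powersetCard ℓ X, g (W ∩ U).card =
      ∑ j ∈ Finset.range ((X ∩ U).card + 1),
        if j ≤ ℓ then ((X ∩ U).card.choose j : ℝ) * (X \ U).card.choose (ℓ - j) * g j else 0 := by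
  have hu : (X ∩ U) ∪ (X \ U) = X := by rw [Finset.union_comm, Finset.sdiff_union_inter]
  have hd : Disjoint (X ∩ U) (X \ U) := (Finset.disjoint_sdiff_inter X U).symm
  rw [Finset.powersetCard_eq_filter, Finset.sum_filter]
  nth_rw 1 [← hu]
  rw [sum_powerset_disjUnion hd]
  have key : ∀ y ∈ (X ∩ U).powerset, ∑ z ∈ (X \ U).powerset,
      (if (y ∪ z).card = ℓ then g ((y ∪ z) ∩ U).card else 0) =
      (fun j => if j ≤ ℓ then ((X \ U).card.choose (ℓ - j) : ℝ) * g j else 0) y.card := by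
    intro y hy
    have hy' := Finset.mem_powerset.mp hy
    have hyU : y ⊆ U := hy'.trans Finset.inter_subset_right
    have hz : ∀ z ∈ (X \ U).powerset, (if (y ∪ z).card = ℓ then g ((y ∪ z) ∩ U).card else 0) =
        if y.card ≤ ℓ ∧ z.card = ℓ - y.card then g y.card else 0 := by
      intro z hz
      have hz' := Finset.mem_powerset.mp hz
      have hzU : Disjoint z U := Finset.disjoint_of_subset_left hz' Finset.sdiff_disjoint
      rw [Finset.card_union_of_disjoint (hd.mono hy' hz'), Finset.union_inter_distrib_right,
        Finset.disjoint_iff_inter_eq_empty.mp hzU, Finset.union_empty,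
        Finset.inter_eq_left.mpr hyU]
      congr 1
      exact propext (by omega)
    rw [Finset.sum_congr rfl hz]
    by_cases hl : y.card ≤ ℓ
    · simp only [hl, true_and, if_true]
      rw [← Finset.sum_filter, ← Finset.powersetCard_eq_filter, Finset.sum_const,
        Finset.card_powersetCard, nsmul_eq_mul]
    · simp [hl]
  rw [Finset.sum_congr rfl key]
  refine (Finset.sum_powerset_apply_card
    (fun j => if j ≤ ℓ then ((X \ U).card.choose (ℓ - j) : ℝ) * g j else 0)).trans ?_
  refine Finset.sum_congr rfl fun j _ => ?_
  rw [nsmul_eq_mul, mul_ite, mul_zero, mul_assoc]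

theorem pairSign_eq (m : ℕ) (U : Finset ℕ) :
    pairSign m U = if ∀ r ∈ Icc 1 m, (2 * r - 1 ∈ U ↔ ¬ 2 * r ∈ U) then
      (-1 : ℝ) ^ (U ∩ (Finset.range m).image (fun r => 2 * r + 1)).card else 0 := by
  split_ifs with h
  · have hcard : (U ∩ (Finset.range m).image (fun r => 2 * r + 1)).card =
        ((Finset.range m).filter fun r => 2 * r + 1 ∈ U).card := by
      rw [Finset.inter_comm, ← Finset.filter_mem_eq_inter, Finset.filter_image,
        Finset.card_image_of_injective _ fun a b hab => by simpa using hab]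
    rw [hcard, ← Finset.prod_const, Finset.prod_filter, pairSign]
    refine Finset.prod_congr rfl fun r hr => ?_
    have h' := h (r + 1) (Finset.mem_Icc.mpr ⟨by omega, Finset.mem_range.mp hr⟩)
    rw [show 2 * (r + 1) - 1 = 2 * r + 1 by omega, show 2 * (r + 1) = 2 * r + 2 by ring] at h'
    by_cases h1 : 2 * r + 1 ∈ U <;> by_cases h2 : 2 * r + 2 ∈ U <;> simp_all
  · push Not at h
    obtain ⟨r, hr, hr'⟩ := h
    obtain ⟨hr1, hrm⟩ := Finset.mem_Icc.mp hr
    obtain ⟨s, rfl⟩ : ∃ s, r = s + 1 := ⟨r - 1, by omega⟩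
    rw [show 2 * (s + 1) - 1 = 2 * s + 1 by omega, show 2 * (s + 1) = 2 * s + 2 by ring] at hr'
    refine Finset.prod_eq_zero (Finset.mem_range.mpr hrm) ?_
    by_cases h1 : 2 * s + 1 ∈ U <;> by_cases h2 : 2 * s + 2 ∈ U <;> simp_all

theorem fT_eq_pairSign_mul (n m ℓ : ℕ) (U : Finset ℕ) :
    fT n m ℓ U = pairSign m U * Tcoef n m ℓ (U ∩ Icc (2 * m + 1) n).card := by
  have hi : (U ∩ Icc (2 * m + 1) n).card ∈ Finset.range (n - 2 * m + 1) := by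
    have := Finset.card_le_card (Finset.inter_subset_right (s₁ := U) (s₂ := Icc (2 * m + 1) n))
    rw [Nat.card_Icc] at this
    rw [Finset.mem_range]
    omega
  rw [fT, Finset.sum_eq_single_of_mem _ hi, gT, pairSign_eq]
  · simp only [and_true]
    ring
  · intro i _ hne
    rw [gT, if_neg fun h => hne h.2.symm, mul_zero]

theorem fT_eq_sum_pairVec (n m ℓ : ℕ) (U : Finset ℕ) :
    fT n m ℓ U =
      (-1) ^ m * ∑ W ∈ Finset.powersetCard ℓ (Icc (2 * m + 1) n), pairVec m W U := by
  have h : ∑ W ∈ Finset.powersetCard ℓ (Icc (2 * m + 1) n), pairVec m W U =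
      pairSign m U * ∑ W ∈ Finset.powersetCard ℓ (Icc (2 * m + 1) n),
        (fun j => (-1 : ℝ) ^ j * (ℓ + 2 * m).choose (j + m)) (W ∩ U).card := by
    rw [Finset.mul_sum]
    refine Finset.sum_congr rfl fun W hW => ?_
    rw [pairVec, (Finset.mem_powersetCard.mp hW).2]
  have hs : (Icc (2 * m + 1) n \ U).card = n - 2 * m - (U ∩ Icc (2 * m + 1) n).card := by
    rw [Finset.card_sdiff, Nat.card_Icc]
    omega
  rw [h, sum_powersetCard_inter _ _ _ fun j => (-1 : ℝ) ^ j * (ℓ + 2 * m).choose (j + m),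
    fT_eq_pairSign_mul, hs, Finset.inter_comm, Tcoef, mul_left_comm, Finset.mul_sum _ _ ((-1) ^ m)]
  congr 1
  refine Finset.sum_congr rfl fun j _ => ?_
  rw [mul_ite, mul_zero, add_comm ℓ, add_comm j, pow_add]
  congr 1
  ring

theorem isKEigen_fT {n m : ℕ} (hm : 2 * m ≤ n) (ℓ : ℕ) :
    IsKEigen n (burnsideEigenvalue (m + ℓ)) (fT n m ℓ) := by
  have h : IsKEigen n (burnsideEigenvalue (m + ℓ)) fun U =>
      ∑ W ∈ Finset.powersetCard ℓ (Icc (2 * m + 1) n), pairVec m W U := by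
    refine IsKEigen.sum fun W hW => ?_
    obtain ⟨h1, h2⟩ := Finset.mem_powersetCard.mp hW
    have := isKEigen_pairVec hm h1
    rwa [h2, add_comm ℓ] at this
  exact (h.const_mul ((-1) ^ m)).congr fun U _ => fT_eq_sum_pairVec n m ℓ U

theorem exists_fT_ne_zero {n m ℓ : ℕ} (hm : 2 * m ≤ n) (hℓ : ℓ ≤ n - 2 * m) :
    ∃ U ⊆ Icc 1 n, fT n m ℓ U ≠ 0 := by
  refine ⟨(Finset.range m).image fun r => 2 * r + 1, ?_, ?_⟩
  · intro a ha
    obtain ⟨r, hr, rfl⟩ := Finset.mem_image.mp ha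
    have := Finset.mem_range.mp hr
    rw [Finset.mem_Icc]
    omega
  · have h0 : (((Finset.range m).image fun r => 2 * r + 1) ∩ Icc (2 * m + 1) n).card = 0 := by
      rw [Finset.card_eq_zero, Finset.eq_empty_iff_forall_notMem]
      intro a ha
      obtain ⟨ha1, ha2⟩ := Finset.mem_inter.mp ha
      obtain ⟨r, hr, rfl⟩ := Finset.mem_image.mp ha1
      have := Finset.mem_range.mp hr
      have := Finset.mem_Icc.mp ha2
      omega
    rw [fT_eq_pairSign_mul, h0]
    apply mul_ne_zero
    · rw [pairSign, Finset.prod_ne_zero_iff]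
      intro r hr
      have h1 : 2 * r + 1 ∈ (Finset.range m).image fun r => 2 * r + 1 :=
        Finset.mem_image_of_mem _ hr
      have h2 : 2 * r + 2 ∉ (Finset.range m).image fun r => 2 * r + 1 := by
        simp only [Finset.mem_image, not_exists, not_and]
        intro s _
        omega
      simp [h1, h2]
    · have h1 : (2 * m + ℓ).choose m ≠ 0 := (Nat.choose_pos (by omega)).ne'
      have h2 : (n - 2 * m).choose ℓ ≠ 0 := (Nat.choose_pos hℓ).ne'
      simp [Tcoef, h1, h2]

/-- For every 0 ≤ m ≤ ⌊n/2⌋, standard Young tableau Q of shape (n−m,m)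
and 0 ≤ ℓ ≤ n−2m, the function f_Q^{m,ℓ} is nonzero and is an eigenvector of K_n with
eigenvalue β_{(m+ℓ)/2} if m+ℓ is even and 0 if m+ℓ is odd. -/
theorem fQ_eigenvector (n m ℓ : ℕ) (Q : List ℕ) (hm : 2 * m ≤ n) (hQm : Q.length = m)
    (hQ : IsSYT n Q) (hℓ : ℓ ≤ n - 2 * m) :
    (∃ U ⊆ Finset.Icc 1 n, fQvec n Q ℓ U ≠ 0) ∧
    (∀ k, m + ℓ = 2 * k →
      ∀ U ⊆ Finset.Icc 1 n, Kop n (fQvec n Q ℓ) U = betaEV k * fQvec n Q ℓ U) ∧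
    (Odd (m + ℓ) → ∀ U ⊆ Finset.Icc 1 n, Kop n (fQvec n Q ℓ) U = 0) := by
  subst hQm
  have h := (isKEigen_fT hm ℓ).tauQAux le_rfl hQ.2.1
  refine ⟨exists_tauQAux_ne_zero le_rfl hQ.2.1 (exists_fT_ne_zero hm hℓ), ?_, ?_⟩
  · intro k hk
    rwa [hk, burnsideEigenvalue_even] at h
  · intro hodd U hU
    have := h U hU
    rwa [burnsideEigenvalue_odd hodd, zero_mul] at this
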